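/- arXiv:2103.09854 — 10 statements merged into one kernel-verified Lean document; each statement's English description precedes it below -/
import Mathlib

section
/- Let μ be the almost-abelian Lie bracket on ℝ⁶ determined by data (a, v, A) with A commuting with J|_{n₁}. Then the complex-valued 3-form Ψ = (e¹+ie⁶)∧(e²+ie⁵)∧(e³+ie⁴) satisfies dΨ = 0 (Chevalley–Eilenberg differential extended ℂ-linearly) if and only if tr A = −2a and tr(J|_{n₁}∘A) = 0. Equivalently, dΨ = ((a+A₂²+A₃³) − i(A₂⁵+A₃⁴))·(e^{1236} + i e^{1246} − i e^{1356} + e^{1456}), where A_i^j := e^i(A e_j). -/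
noncomputable section

open Matrix

/-- The underlying vector space `ℝ⁶` of the almost-abelian Lie algebra. -/
abbrev V6 := Fin 6 → ℝ

/-- The standard basis `e₁, …, e₆` (0-indexed: `ee 0 = e₁`, …, `ee 5 = e₆`). -/
def ee (i : Fin 6) : V6 := Pi.single i 1

/-- The matrix of `J` restricted to `n₁ = span(e₂,e₃,e₄,e₅)` in the basis `(e₂,e₃,e₄,e₅)`:
`Je₂ = e₅, Je₃ = e₄, Je₄ = −e₃, Je₅ = −e₂`. -/
def J4 : Matrix (Fin 4) (Fin 4) ℝ := !![0,0,0,-1; 0,0,-1,0; 0,1,0,0; 1,0,0,0]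

/-- The derivation `ad_{e₆}` of the abelian ideal `n = span(e₁,…,e₅)` determined by the
data `(a, v, A)`:  `ad_{e₆}(e₁) = a e₁ + v` with `v = v₂e₂+v₃e₃+v₄e₄+v₅e₅ ∈ n₁`, and
`ad_{e₆}(x) = A x` for `x ∈ n₁ = span(e₂,e₃,e₄,e₅)`. -/
def bDg (a v2 v3 v4 v5 : ℝ) (A : Matrix (Fin 4) (Fin 4) ℝ) (x : V6) : V6 :=
  ![a * x 0,
    v2 * x 0 + A 0 0 * x 1 + A 0 1 * x 2 + A 0 2 * x 3 + A 0 3 * x 4,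
    v3 * x 0 + A 1 0 * x 1 + A 1 1 * x 2 + A 1 2 * x 3 + A 1 3 * x 4,
    v4 * x 0 + A 2 0 * x 1 + A 2 1 * x 2 + A 2 2 * x 3 + A 2 3 * x 4,
    v5 * x 0 + A 3 0 * x 1 + A 3 1 * x 2 + A 3 2 * x 3 + A 3 3 * x 4,
    0]

/-- The almost-abelian Lie bracket on `ℝ⁶` determined by the data `(a, v, A)`. -/
def brg (a v2 v3 v4 v5 : ℝ) (A : Matrix (Fin 4) (Fin 4) ℝ) (x y : V6) : V6 :=
  fun i => x 5 * bDg a v2 v3 v4 v5 A y i - y 5 * bDg a v2 v3 v4 v5 A x i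

/-- The complex 1-form `ζ¹ = e¹ + i e⁶`. -/
def zeta1 (x : V6) : ℂ := (x 0 : ℂ) + Complex.I * (x 5 : ℂ)

/-- The complex 1-form `ζ² = e² + i e⁵`. -/
def zeta2 (x : V6) : ℂ := (x 1 : ℂ) + Complex.I * (x 4 : ℂ)

/-- The complex 1-form `ζ³ = e³ + i e⁴`. -/
def zeta3 (x : V6) : ℂ := (x 2 : ℂ) + Complex.I * (x 3 : ℂ)

/-- The complex 3-form `Ψ = (e¹+ie⁶) ∧ (e²+ie⁵) ∧ (e³+ie⁴)`. -/
def Psi (x y z : V6) : ℂ :=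
  Matrix.det !![zeta1 x, zeta2 x, zeta3 x; zeta1 y, zeta2 y, zeta3 y;
                zeta1 z, zeta2 z, zeta3 z]

/-- Chevalley–Eilenberg differential (extended ℂ-linearly) of a ℂ-valued 3-form. -/
def d3c (B : V6 → V6 → V6) (α : V6 → V6 → V6 → ℂ) (x0 x1 x2 x3 : V6) : ℂ :=
  -α (B x0 x1) x2 x3 + α (B x0 x2) x1 x3 - α (B x0 x3) x1 x2
    - α (B x1 x2) x0 x3 + α (B x1 x3) x0 x2 - α (B x2 x3) x0 x1

/-- The complexified basis 4-form `e^i ∧ e^j ∧ e^k ∧ e^l` (0-indexed). -/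
def E4c (i j k l : Fin 6) (x0 x1 x2 x3 : V6) : ℂ :=
  ((Matrix.det !![x0 i, x0 j, x0 k, x0 l; x1 i, x1 j, x1 k, x1 l;
                  x2 i, x2 j, x2 k, x2 l; x3 i, x3 j, x3 k, x3 l] : ℝ) : ℂ)

/-- The entries of a matrix commuting with `J4`. -/
theorem comm_entries (A : Matrix (Fin 4) (Fin 4) ℝ) (hA : A * J4 = J4 * A) :
    A 3 3 = A 0 0 ∧ A 3 0 = -A 0 3 ∧ A 3 2 = A 0 1 ∧ A 3 1 = -A 0 2 ∧
    A 2 2 = A 1 1 ∧ A 2 1 = -A 1 2 ∧ A 2 3 = A 1 0 ∧ A 2 0 = -A 1 3 := by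
  have h : ∀ i j, (A * J4) i j = (J4 * A) i j := fun i j => by rw [hA]
  have h00 := h 0 0
  have h01 := h 0 1
  have h02 := h 0 2
  have h03 := h 0 3
  have h10 := h 1 0
  have h11 := h 1 1
  have h12 := h 1 2
  have h13 := h 1 3
  simp [Matrix.mul_apply, Fin.sum_univ_four, J4] at h00 h01 h02 h03 h10 h11 h12 h13
  refine ⟨?_, ?_, ?_, ?_, ?_, ?_, ?_, ?_⟩ <;> linarith

theorem zeta1_brg (a v2 v3 v4 v5 : ℝ) (A : Matrix (Fin 4) (Fin 4) ℝ) (x y : V6) :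
    zeta1 (brg a v2 v3 v4 v5 A x y) = x 5 * (a * y 0) - y 5 * (a * x 0) := by
  simp [zeta1, brg, bDg]

theorem zeta2_brg (a v2 v3 v4 v5 : ℝ) (A : Matrix (Fin 4) (Fin 4) ℝ)
    (hA : A * J4 = J4 * A) (x y : V6) :
    zeta2 (brg a v2 v3 v4 v5 A x y) =
      x 5 * ((v2 + Complex.I * v5) * y 0 + (A 0 0 - Complex.I * A 0 3) * zeta2 y
        + (A 0 1 - Complex.I * A 0 2) * zeta3 y)
      - y 5 * ((v2 + Complex.I * v5) * x 0 + (A 0 0 - Complex.I * A 0 3) * zeta2 x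
        + (A 0 1 - Complex.I * A 0 2) * zeta3 x) := by
  obtain ⟨h1, h2, h3, h4, h5, h6, h7, h8⟩ := comm_entries A hA
  simp [zeta2, zeta3, brg, bDg, h1, h2, h3, h4]
  ring_nf
  simp only [Complex.I_sq]
  ring

theorem zeta3_brg (a v2 v3 v4 v5 : ℝ) (A : Matrix (Fin 4) (Fin 4) ℝ)
    (hA : A * J4 = J4 * A) (x y : V6) :
    zeta3 (brg a v2 v3 v4 v5 A x y) =
      x 5 * ((v3 + Complex.I * v4) * y 0 + (A 1 0 - Complex.I * A 1 3) * zeta2 y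
        + (A 1 1 - Complex.I * A 1 2) * zeta3 y)
      - y 5 * ((v3 + Complex.I * v4) * x 0 + (A 1 0 - Complex.I * A 1 3) * zeta2 x
        + (A 1 1 - Complex.I * A 1 2) * zeta3 x) := by
  obtain ⟨h1, h2, h3, h4, h5, h6, h7, h8⟩ := comm_entries A hA
  simp [zeta2, zeta3, brg, bDg, h5, h6, h7, h8]
  ring_nf
  simp only [Complex.I_sq]
  ring

/-- The explicit determinant with rows `(e¹, ζ², ζ³, e⁶)`. -/
def D4 (p0 p1 p2 p3 z0 z1 z2 z3 w0 w1 w2 w3 q0 q1 q2 q3 : ℂ) : ℂ :=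
  Matrix.det !![p0, z0, w0, q0; p1, z1, w1, q1; p2, z2, w2, q2; p3, z3, w3, q3]

theorem E4c_sum (x0 x1 x2 x3 : V6) :
    E4c 0 1 2 5 x0 x1 x2 x3 + Complex.I * E4c 0 1 3 5 x0 x1 x2 x3
      - Complex.I * E4c 0 2 4 5 x0 x1 x2 x3 + E4c 0 3 4 5 x0 x1 x2 x3 =
    D4 (x0 0) (x1 0) (x2 0) (x3 0) (zeta2 x0) (zeta2 x1) (zeta2 x2) (zeta2 x3)
      (zeta3 x0) (zeta3 x1) (zeta3 x2) (zeta3 x3) (x0 5) (x1 5) (x2 5) (x3 5) := by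
  simp [D4, E4c, zeta2, zeta3, Matrix.det_succ_row_zero, Fin.sum_univ_succ, Fin.succAbove]
  ring_nf
  simp only [Complex.I_sq]
  ring

theorem dPsi_formula (a v2 v3 v4 v5 : ℝ) (A : Matrix (Fin 4) (Fin 4) ℝ)
    (hA : A * J4 = J4 * A) (x0 x1 x2 x3 : V6) :
      d3c (brg a v2 v3 v4 v5 A) Psi x0 x1 x2 x3 =
        (((a + A 0 0 + A 1 1 : ℝ) : ℂ) - Complex.I * ((A 0 3 + A 1 2 : ℝ) : ℂ)) *
          (E4c 0 1 2 5 x0 x1 x2 x3 + Complex.I * E4c 0 1 3 5 x0 x1 x2 x3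
            - Complex.I * E4c 0 2 4 5 x0 x1 x2 x3 + E4c 0 3 4 5 x0 x1 x2 x3) := by
  have hm : ((a + A 0 0 + A 1 1 : ℝ) : ℂ) - Complex.I * ((A 0 3 + A 1 2 : ℝ) : ℂ) =
      a + (A 0 0 - Complex.I * A 0 3) + (A 1 1 - Complex.I * A 1 2) := by
    push_cast; ring
  have hz : ∀ x : V6, zeta1 x = x 0 + Complex.I * x 5 := fun _ => rfl
  rw [E4c_sum, hm]
  simp only [d3c, Psi, zeta1_brg, zeta2_brg _ _ _ _ _ A hA,
    zeta3_brg _ _ _ _ _ A hA]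
  simp only [hz]
  generalize (A 0 0 - Complex.I * A 0 3 : ℂ) = m00
  generalize (A 0 1 - Complex.I * A 0 2 : ℂ) = m01
  generalize (A 1 0 - Complex.I * A 1 3 : ℂ) = m10
  generalize (A 1 1 - Complex.I * A 1 2 : ℂ) = m11
  generalize (v2 + Complex.I * v5 : ℂ) = u
  generalize (v3 + Complex.I * v4 : ℂ) = w
  simp [D4, Matrix.det_succ_row_zero, Fin.sum_univ_succ, Fin.succAbove]
  ring

/-- For the almost-abelian bracket determined by `(a, v, A)` with `A`
commuting with `J|_{n₁}`, the 3-form `Ψ = (e¹+ie⁶)∧(e²+ie⁵)∧(e³+ie⁴)` satisfies `dΨ = 0`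
iff `tr A = −2a` and `tr(J|_{n₁}∘A) = 0`; equivalently
`dΨ = ((a+A₂²+A₃³) − i(A₂⁵+A₃⁴))·(e^{1236} + i e^{1246} − i e^{1356} + e^{1456})`
(with `A₂² = A 0 0`, `A₃³ = A 1 1`, `A₂⁵ = A 0 3`, `A₃⁴ = A 1 2`). -/
theorem stmt0 (a v2 v3 v4 v5 : ℝ) (A : Matrix (Fin 4) (Fin 4) ℝ)
    (hA : A * J4 = J4 * A) :
    ((∀ x0 x1 x2 x3 : V6, d3c (brg a v2 v3 v4 v5 A) Psi x0 x1 x2 x3 = 0) ↔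
        (Matrix.trace A = -2 * a ∧ Matrix.trace (J4 * A) = 0)) ∧
    (∀ x0 x1 x2 x3 : V6,
      d3c (brg a v2 v3 v4 v5 A) Psi x0 x1 x2 x3 =
        (((a + A 0 0 + A 1 1 : ℝ) : ℂ) - Complex.I * ((A 0 3 + A 1 2 : ℝ) : ℂ)) *
          (E4c 0 1 2 5 x0 x1 x2 x3 + Complex.I * E4c 0 1 3 5 x0 x1 x2 x3
            - Complex.I * E4c 0 2 4 5 x0 x1 x2 x3 + E4c 0 3 4 5 x0 x1 x2 x3)) := by
  refine ⟨?_, dPsi_formula a v2 v3 v4 v5 A hA⟩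
  obtain ⟨h1, h2, h3, h4, h5, h6, h7, h8⟩ := comm_entries A hA
  have ht : Matrix.trace A = 2 * (A 0 0 + A 1 1) := by
    simp [Matrix.trace, Fin.sum_univ_four, h1, h5]
    ring
  have hj : Matrix.trace (J4 * A) = 2 * (A 0 3 + A 1 2) := by
    simp only [Matrix.trace, Matrix.diag_apply, Fin.sum_univ_four, Matrix.mul_apply]
    simp [J4, h2, h6]
    ring
  rw [ht, hj]
  constructor
  · intro h
    have h0 := h (ee 0) (ee 1) (ee 2) (ee 5)
    rw [dPsi_formula a v2 v3 v4 v5 A hA] at h0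
    have hE : E4c 0 1 2 5 (ee 0) (ee 1) (ee 2) (ee 5) + Complex.I *
        E4c 0 1 3 5 (ee 0) (ee 1) (ee 2) (ee 5)
        - Complex.I * E4c 0 2 4 5 (ee 0) (ee 1) (ee 2) (ee 5)
        + E4c 0 3 4 5 (ee 0) (ee 1) (ee 2) (ee 5) = 1 := by
      simp [E4c, ee, Matrix.det_succ_row_zero, Fin.sum_univ_succ, Fin.succAbove, Pi.single_apply]
    rw [hE, mul_one] at h0
    have hr := congrArg Complex.re h0
    have hi := congrArg Complex.im h0
    simp at hr hi
    constructor <;> linarith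
  · rintro ⟨ha, hb⟩ x0 x1 x2 x3
    rw [dPsi_formula a v2 v3 v4 v5 A hA]
    have e1 : a + A 0 0 + A 1 1 = 0 := by linarith
    have e2 : A 0 3 + A 1 2 = 0 := by linarith
    rw [e1, e2]
    simp
end
end

section
/- Let μ be the almost-abelian Lie bracket on ℝ⁶ determined by data (a, v, A) with A commuting with J|_{n₁}. Then the Hermitian structure (ω, J) is balanced, i.e. d(ω∧ω) = 0 for the Chevalley–Eilenberg differential, if and only if tr A = 0 and v = 0. -/
noncomputable section

open Matrix

/-- The fundamental 2-form `ω = e^{16} + e^{25} + e^{34}` (0-indexed). -/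
def omega2 (x y : V6) : ℝ :=
  (x 0 * y 5 - x 5 * y 0) + (x 1 * y 4 - x 4 * y 1) + (x 2 * y 3 - x 3 * y 2)

/-- Wedge product of two 2-forms. -/
def w22 (α β : V6 → V6 → ℝ) (x0 x1 x2 x3 : V6) : ℝ :=
  α x0 x1 * β x2 x3 - α x0 x2 * β x1 x3 + α x0 x3 * β x1 x2
    + α x1 x2 * β x0 x3 - α x1 x3 * β x0 x2 + α x2 x3 * β x0 x1

/-- Chevalley–Eilenberg differential of a 4-form:
`dα(x₀,…,x₄) = Σ_{i<j} (−1)^{i+j} α([x_i,x_j], x₀,…,x̂_i,…,x̂_j,…,x₄)`. -/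
def d4 (B : V6 → V6 → V6) (α : V6 → V6 → V6 → V6 → ℝ) (x0 x1 x2 x3 x4 : V6) : ℝ :=
  -α (B x0 x1) x2 x3 x4 + α (B x0 x2) x1 x3 x4 - α (B x0 x3) x1 x2 x4
    + α (B x0 x4) x1 x2 x3 - α (B x1 x2) x0 x3 x4 + α (B x1 x3) x0 x2 x4
    - α (B x1 x4) x0 x2 x3 - α (B x2 x3) x0 x1 x4 + α (B x2 x4) x0 x1 x3
    - α (B x3 x4) x0 x1 x2

/-- For the almost-abelian bracket determined by `(a, v, A)` with `A`
commuting with `J|_{n₁}`, the Hermitian structure `(ω, J)` is balanced, i.e.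
`d(ω∧ω) = 0`, if and only if `tr A = 0` and `v = 0`. -/
theorem stmt1 (a v2 v3 v4 v5 : ℝ) (A : Matrix (Fin 4) (Fin 4) ℝ)
    (hA : A * J4 = J4 * A) :
    (∀ x0 x1 x2 x3 x4 : V6,
        d4 (brg a v2 v3 v4 v5 A) (w22 omega2 omega2) x0 x1 x2 x3 x4 = 0) ↔
      (Matrix.trace A = 0 ∧ v2 = 0 ∧ v3 = 0 ∧ v4 = 0 ∧ v5 = 0) := by
  clear hA
  constructor
  · intro h
    have h1 := h (Pi.single 5 1) (Pi.single 1 1) (Pi.single 2 1) (Pi.single 3 1) (Pi.single 4 1)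
    have h2 := h (Pi.single 5 1) (Pi.single 0 1) (Pi.single 2 1) (Pi.single 3 1) (Pi.single 4 1)
    have h3 := h (Pi.single 5 1) (Pi.single 0 1) (Pi.single 1 1) (Pi.single 3 1) (Pi.single 4 1)
    have h4 := h (Pi.single 5 1) (Pi.single 0 1) (Pi.single 1 1) (Pi.single 2 1) (Pi.single 4 1)
    have h5 := h (Pi.single 5 1) (Pi.single 0 1) (Pi.single 1 1) (Pi.single 2 1) (Pi.single 3 1)
    simp [d4, brg, w22, omega2, bDg, Pi.single_apply] at h1 h2 h3 h4 h5
    refine ⟨?_, ?_, ?_, ?_, ?_⟩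
    · simp only [Matrix.trace, Matrix.diag, Fin.sum_univ_four]
      linarith
    all_goals linarith
  · rintro ⟨ht, rfl, rfl, rfl, rfl⟩ x0 x1 x2 x3 x4
    simp only [Matrix.trace, Matrix.diag, Fin.sum_univ_four] at ht
    have h33 : A 3 3 = -(A 0 0 + A 1 1 + A 2 2) := by linarith
    simp [d4, brg, w22, omega2, bDg, h33]
    ring
end
end

section
/- Under the balanced almost-abelian structure equations, the 4-form i∂∂̄ω = d(d^cω) equals −2[A₂²(A₂⁴+A₃⁵) − A₂⁵(A₂³+A₃²)]·(e^{1236} − e^{1456}) + 2[A₂²(A₂³−A₃²) + A₂⁵(A₂⁴−A₃⁵)]·(e^{1246} + e^{1356}) + 2[2(A₂²)² + (A₃²)² + (A₃⁵)² + A₂³A₃² − A₂⁴A₃⁵]·e^{1256} + 2[2(A₂²)² + (A₂³)² + (A₂⁴)² + A₂³A₃² − A₂⁴A₃⁵]·e^{1346}. -/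
noncomputable section

open Matrix

/-- The complex structure `J`: `Je₁ = e₆, Je₂ = e₅, Je₃ = e₄, Je₄ = −e₃, Je₅ = −e₂, Je₆ = −e₁`. -/
def Jm (x : V6) : V6 := ![-x 5, -x 4, -x 3, x 2, x 1, x 0]

/-- The matrix `A` of `ad_{e₆}|_{n₁}` in the basis `(e₂,e₃,e₄,e₅)` determined by the
balanced almost-abelian structure equations with parameters
`p = A₂², q = A₂³, r = A₂⁴, s = A₂⁵, u = A₃², w = A₃⁵`. -/
def Amat (p q r s u w : ℝ) : Matrix (Fin 4) (Fin 4) ℝ :=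
  !![p, q, r, s; u, -p, -s, w; -w, s, -p, u; -s, -r, q, p]

/-- The derivation `ad_{e₆}` of the abelian ideal `n`, given by the balanced
almost-abelian structure equations. -/
def bD (p q r s u w : ℝ) (x : V6) : V6 :=
  ![0,
    p * x 1 + q * x 2 + r * x 3 + s * x 4,
    u * x 1 - p * x 2 - s * x 3 + w * x 4,
    -w * x 1 + s * x 2 - p * x 3 + u * x 4,
    -s * x 1 - r * x 2 + q * x 3 + p * x 4,
    0]

/-- The balanced almost-abelian Lie bracket on `ℝ⁶`. -/
def br (p q r s u w : ℝ) (x y : V6) : V6 :=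
  fun i => x 5 * bD p q r s u w y i - y 5 * bD p q r s u w x i

/-- Chevalley–Eilenberg differential of a 1-form. -/
def d1 (B : V6 → V6 → V6) (α : V6 → ℝ) (x0 x1 : V6) : ℝ := -α (B x0 x1)

/-- Chevalley–Eilenberg differential of a 2-form. -/
def d2 (B : V6 → V6 → V6) (α : V6 → V6 → ℝ) (x0 x1 x2 : V6) : ℝ :=
  -α (B x0 x1) x2 + α (B x0 x2) x1 - α (B x1 x2) x0

/-- Chevalley–Eilenberg differential of a 3-form. -/
def d3 (B : V6 → V6 → V6) (α : V6 → V6 → V6 → ℝ) (x0 x1 x2 x3 : V6) : ℝ :=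
  -α (B x0 x1) x2 x3 + α (B x0 x2) x1 x3 - α (B x0 x3) x1 x2
    - α (B x1 x2) x0 x3 + α (B x1 x3) x0 x2 - α (B x2 x3) x0 x1

/-- Structure constants `c^i_{jk} = e^i([e_j, e_k])` of the Lie bracket,
i.e. `[e_j, e_k] = Σ_i c^i_{jk} e_i`, entering the Koszul/Gauduchon formula for `σ^τ`. -/
def cst (p q r s u w : ℝ) (i j k : Fin 6) : ℝ := (br p q r s u w (ee j) (ee k)) i

/-- The 3-form `dω`. -/
def dOmega (p q r s u w : ℝ) : V6 → V6 → V6 → ℝ := d2 (br p q r s u w) omega2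

/-- The Gauduchon connection 1-forms
`(σ^τ)^i_j(e_k) = ½(c^i_{jk} − c^k_{ij} + c^j_{ki}) + ((τ−1)/4)·dω(Je_k,Je_j,Je_i)
  + ((τ+1)/4)·dω(Je_k,e_j,e_i)`, extended linearly. -/
def sigma (p q r s u w τ : ℝ) (i j : Fin 6) : V6 → ℝ := fun x =>
  ∑ k : Fin 6, x k *
    ((1/2) * (cst p q r s u w i j k - cst p q r s u w k i j + cst p q r s u w j k i)
      + (τ - 1)/4 * dOmega p q r s u w (Jm (ee k)) (Jm (ee j)) (Jm (ee i))
      + (τ + 1)/4 * dOmega p q r s u w (Jm (ee k)) (ee j) (ee i))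

/-- Wedge product of two 1-forms. -/
def w11 (α β : V6 → ℝ) (x0 x1 : V6) : ℝ := α x0 * β x1 - α x1 * β x0

/-- The curvature 2-forms `(Ω^τ)^i_j = d(σ^τ)^i_j + Σ_k (σ^τ)^i_k ∧ (σ^τ)^k_j`. -/
def Omega (p q r s u w τ : ℝ) (i j : Fin 6) (x0 x1 : V6) : ℝ :=
  d1 (br p q r s u w) (sigma p q r s u w τ i j) x0 x1
    + ∑ k : Fin 6, w11 (sigma p q r s u w τ i k) (sigma p q r s u w τ k j) x0 x1

/-- The 4-form `tr(Ω^τ ∧ Ω^τ) = Σ_{i<j} (Ω^τ)^i_j ∧ (Ω^τ)^i_j`. -/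
def trOmOm (p q r s u w τ : ℝ) (x0 x1 x2 x3 : V6) : ℝ :=
  ∑ i : Fin 6, ∑ j : Fin 6,
    if i < j then w22 (Omega p q r s u w τ i j) (Omega p q r s u w τ i j) x0 x1 x2 x3 else 0

/-- The 3-form `d^cω(X,Y,Z) = −dω(JX,JY,JZ)`. -/
def dcOmega (p q r s u w : ℝ) (x0 x1 x2 : V6) : ℝ :=
  -dOmega p q r s u w (Jm x0) (Jm x1) (Jm x2)

/-- The 4-form `i∂∂̄ω = d(d^cω)`. -/
def iddbar (p q r s u w : ℝ) : V6 → V6 → V6 → V6 → ℝ :=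
  d3 (br p q r s u w) (dcOmega p q r s u w)

/-- The basis 4-form `e^i ∧ e^j ∧ e^k ∧ e^l` (0-indexed). -/
def E4 (i j k l : Fin 6) (x0 x1 x2 x3 : V6) : ℝ :=
  Matrix.det !![x0 i, x0 j, x0 k, x0 l; x1 i, x1 j, x1 k, x1 l;
                x2 i, x2 j, x2 k, x2 l; x3 i, x3 j, x3 k, x3 l]

/-- Expanded form of `E4`. -/
lemma E4_expand (i j k l : Fin 6) (a b c d : V6) :
    E4 i j k l a b c d =
      (a i * b j - a j * b i) * (c k * d l - c l * d k)
      - (a i * b k - a k * b i) * (c j * d l - c l * d j)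
      + (a i * b l - a l * b i) * (c j * d k - c k * d j)
      + (a j * b k - a k * b j) * (c i * d l - c l * d i)
      - (a j * b l - a l * b j) * (c i * d k - c k * d i)
      + (a k * b l - a l * b k) * (c i * d j - c j * d i) := by
  simp [E4, Matrix.det_succ_row_zero, Fin.sum_univ_succ, Fin.succAbove]
  ring

/-- `d^c ω` evaluated on a vector `x` without `e₁` and `e₆` components. -/
lemma dcOmega_expand (p q r s u w : ℝ) (x y z : V6) (h0 : x 0 = 0) (h5 : x 5 = 0) :
    dcOmega p q r s u w x y z =
      z 0 * (2 * p * (x 1 * y 4 - x 4 * y 1) - 2 * p * (x 2 * y 3 - x 3 * y 2)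
          + (q + u) * (x 2 * y 4 - x 4 * y 2 + (x 1 * y 3 - x 3 * y 1))
          + (r - w) * (x 3 * y 4 - x 4 * y 3 - (x 1 * y 2 - x 2 * y 1)))
      - y 0 * (2 * p * (x 1 * z 4 - x 4 * z 1) - 2 * p * (x 2 * z 3 - x 3 * z 2)
          + (q + u) * (x 2 * z 4 - x 4 * z 2 + (x 1 * z 3 - x 3 * z 1))
          + (r - w) * (x 3 * z 4 - x 4 * z 3 - (x 1 * z 2 - x 2 * z 1))) := by
  simp [dcOmega, dOmega, d2, omega2, br, bD, Jm, h0, h5]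
  ring

/-- Under the balanced almost-abelian structure equations, the 4-form
`i∂∂̄ω = d(d^cω)` equals
`−2[A₂²(A₂⁴+A₃⁵) − A₂⁵(A₂³+A₃²)]·(e^{1236} − e^{1456})
 + 2[A₂²(A₂³−A₃²) + A₂⁵(A₂⁴−A₃⁵)]·(e^{1246} + e^{1356})
 + 2[2(A₂²)² + (A₃²)² + (A₃⁵)² + A₂³A₃² − A₂⁴A₃⁵]·e^{1256}
 + 2[2(A₂²)² + (A₂³)² + (A₂⁴)² + A₂³A₃² − A₂⁴A₃⁵]·e^{1346}`
(with `p = A₂², q = A₂³, r = A₂⁴, s = A₂⁵, u = A₃², w = A₃⁵` and 0-indexed basis forms). -/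
theorem stmt3 (p q r s u w : ℝ) :
    ∀ x0 x1 x2 x3 : V6,
      iddbar p q r s u w x0 x1 x2 x3 =
        -2 * (p * (r + w) - s * (q + u)) *
            (E4 0 1 2 5 x0 x1 x2 x3 - E4 0 3 4 5 x0 x1 x2 x3)
        + 2 * (p * (q - u) + s * (r - w)) *
            (E4 0 1 3 5 x0 x1 x2 x3 + E4 0 2 4 5 x0 x1 x2 x3)
        + 2 * (2 * p ^ 2 + u ^ 2 + w ^ 2 + q * u - r * w) * E4 0 1 4 5 x0 x1 x2 x3
        + 2 * (2 * p ^ 2 + q ^ 2 + r ^ 2 + q * u - r * w) * E4 0 2 3 5 x0 x1 x2 x3 := by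
  intro x0 x1 x2 x3
  have h0 : ∀ x y : V6, br p q r s u w x y 0 = 0 := by
    intro x y; simp [br, bD]
  have h5 : ∀ x y : V6, br p q r s u w x y 5 = 0 := by
    intro x y; simp [br, bD]
  simp only [iddbar, d3, dcOmega_expand _ _ _ _ _ _ _ _ _ (h0 _ _) (h5 _ _), E4_expand]
  simp [br, bD]
  ring
end
end

section
/- Let W be a real vector space, n ≥ 1, and let σ^i_j (1 ≤ i,j ≤ n) be linear functionals on W satisfying σ^i_j = −σ^j_i. Then the alternating 4-form Σ_{1≤i<j≤n} Σ_{k,l=1}^{n} σ^i_k ∧ σ^k_j ∧ σ^i_l ∧ σ^l_j vanishes identically on W. -/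
noncomputable section

/-- The wedge product of four linear functionals, as an alternating 4-form:
`(a ∧ b ∧ c ∧ d)(x₁,…,x₄) = Σ_{π ∈ S₄} sign(π) a(x_{π(1)}) b(x_{π(2)}) c(x_{π(3)}) d(x_{π(4)})`. -/
def wedge4 {W : Type*} [AddCommGroup W] [Module ℝ W] (a b c d : W →ₗ[ℝ] ℝ)
    (x : Fin 4 → W) : ℝ :=
  ∑ π : Equiv.Perm (Fin 4),
    ((Equiv.Perm.sign π : ℤ) : ℝ) * (a (x (π 0)) * b (x (π 1)) * c (x (π 2)) * d (x (π 3)))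

theorem wedge4_eq_det {W : Type*} [AddCommGroup W] [Module ℝ W] (a b c d : W →ₗ[ℝ] ℝ)
    (x : Fin 4 → W) : wedge4 a b c d x =
      Matrix.det (Matrix.of fun i j : Fin 4 => (![a, b, c, d] j) (x i)) := by
  rw [Matrix.det_apply', wedge4]
  refine Finset.sum_congr rfl fun π _ => ?_
  simp [Fin.prod_univ_four]

theorem wedge4_explicit {W : Type*} [AddCommGroup W] [Module ℝ W] (a b c d : W →ₗ[ℝ] ℝ)
    (x : Fin 4 → W) : wedge4 a b c d x =
      (a (x 0) * b (x 1) - a (x 1) * b (x 0)) * (c (x 2) * d (x 3) - c (x 3) * d (x 2))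
      - (a (x 0) * b (x 2) - a (x 2) * b (x 0)) * (c (x 1) * d (x 3) - c (x 3) * d (x 1))
      + (a (x 0) * b (x 3) - a (x 3) * b (x 0)) * (c (x 1) * d (x 2) - c (x 2) * d (x 1))
      + (a (x 1) * b (x 2) - a (x 2) * b (x 1)) * (c (x 0) * d (x 3) - c (x 3) * d (x 0))
      - (a (x 1) * b (x 3) - a (x 3) * b (x 1)) * (c (x 0) * d (x 2) - c (x 2) * d (x 0))
      + (a (x 2) * b (x 3) - a (x 3) * b (x 2)) * (c (x 0) * d (x 1) - c (x 1) * d (x 0)) := by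
  rw [wedge4_eq_det]
  simp [Matrix.det_succ_row_zero, Fin.sum_univ_succ, Fin.succAbove]
  ring

/-- Let `W` be a real vector space, `n ≥ 1`, and `σ^i_j` (`1 ≤ i,j ≤ n`)
linear functionals on `W` with `σ^i_j = −σ^j_i`. Then the alternating 4-form
`Σ_{i<j} Σ_{k,l} σ^i_k ∧ σ^k_j ∧ σ^i_l ∧ σ^l_j` vanishes identically on `W`. -/
theorem stmt4 {W : Type*} [AddCommGroup W] [Module ℝ W] (n : ℕ) (hn : 1 ≤ n)
    (σ : Fin n → Fin n → (W →ₗ[ℝ] ℝ))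
    (hskew : ∀ i j : Fin n, σ i j = -σ j i) :
    ∀ x : Fin 4 → W,
      (∑ i : Fin n, ∑ j : Fin n,
        if i < j then
          ∑ k : Fin n, ∑ l : Fin n, wedge4 (σ i k) (σ k j) (σ i l) (σ l j) x
        else 0) = 0 := by
  intro x
  have hs : ∀ i j y, σ i j y = -σ j i y := fun i j y => by
    rw [hskew i j]; rfl
  set f : Fin n → Fin n → Fin n → Fin n → ℝ :=
    fun i j k l => wedge4 (σ i k) (σ k j) (σ i l) (σ l j) x with hf
  have hsym : ∀ i j k l, f i j k l = f j i k l := by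
    intro i j k l
    simp only [hf, wedge4_explicit, hs j k, hs k i, hs j l, hs l i]
    ring
  have hdiag : ∀ i k l, f i i k l = 0 := by
    intro i k l
    simp only [hf, wedge4_explicit, hs k i, hs l i]
    ring
  have hrot : ∀ i j k l, f i j k l = - f k l j i := by
    intro i j k l
    simp only [hf, wedge4_explicit, hs k i, hs j l]
    ring
  set F : Fin n → Fin n → ℝ := fun i j => ∑ k, ∑ l, f i j k l with hF
  have hFsym : ∀ i j, F i j = F j i := fun i j => by
    simp only [hF]
    exact Finset.sum_congr rfl fun k _ => Finset.sum_congr rfl fun l _ => hsym i j k l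
  have hFdiag : ∀ i, F i i = 0 := fun i => by simp [hF, hdiag]
  have htot : ∑ i, ∑ j, F i j = 0 := by
    have h1 : ∑ i, ∑ j, F i j = ∑ i, ∑ j, ∑ k, ∑ l, f k l j i := by
      simp only [hF]
      calc ∑ i, ∑ j, ∑ k, ∑ l, f i j k l
          = ∑ p : Fin n × Fin n, ∑ q : Fin n × Fin n, f p.1 p.2 q.1 q.2 := by
            simp only [Fintype.sum_prod_type]
        _ = ∑ q : Fin n × Fin n, ∑ p : Fin n × Fin n, f p.1 p.2 q.1 q.2 := Finset.sum_comm
        _ = ∑ j, ∑ i, ∑ k, ∑ l, f k l j i := by simp only [Fintype.sum_prod_type]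
        _ = _ := Finset.sum_comm
    have h2 : ∑ i, ∑ j, F i j = - ∑ i, ∑ j, ∑ k, ∑ l, f k l j i := by
      simp only [hF, ← Finset.sum_neg_distrib]
      exact Finset.sum_congr rfl fun i _ => Finset.sum_congr rfl fun j _ =>
        Finset.sum_congr rfl fun k _ => Finset.sum_congr rfl fun l _ => hrot i j k l
    linarith
  change (∑ i, ∑ j, if i < j then F i j else 0) = 0
  have hsplit : ∑ i, ∑ j, F i j =
      (∑ i, ∑ j, if i < j then F i j else 0) + ∑ i, ∑ j, if j < i then F j i else 0 := by
    simp only [← Finset.sum_add_distrib]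
    refine Finset.sum_congr rfl fun i _ => Finset.sum_congr rfl fun j _ => ?_
    rcases lt_trichotomy i j with h | h | h
    · simp [h, h.not_gt]
    · subst h; simp [hFdiag]
    · simp [h, h.not_gt, hFsym i j]
  have hc : (∑ i, ∑ j, if j < i then F j i else 0) = ∑ i, ∑ j, if i < j then F i j else 0 :=
    Finset.sum_comm
  linarith
end
end

section
/- Under the balanced almost-abelian structure equations, for every τ ∈ ℝ the Gauduchon connection 1-forms satisfy (σ^τ)^1_6 + (σ^τ)^2_5 + (σ^τ)^3_4 = 0 as 1-forms on ℝ⁶. (Equivalently, every Gauduchon connection ∇^τ satisfies ∇^τΨ = 0 for the holomorphic (3,0)-form Ψ = (e¹+ie⁶)∧(e²+ie⁵)∧(e³+ie⁴), i.e. it is an SU(3)-connection.) -/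
noncomputable section

open Matrix

/-- Under the balanced almost-abelian structure equations, for every `τ ∈ ℝ`
the Gauduchon connection 1-forms satisfy `(σ^τ)^1_6 + (σ^τ)^2_5 + (σ^τ)^3_4 = 0`
(0-indexed: `(σ^τ)^0_5 + (σ^τ)^1_4 + (σ^τ)^2_3 = 0`), i.e. `∇^τΨ = 0` and every
Gauduchon connection is an `SU(3)`-connection. -/
theorem stmt5 (p q r s u w τ : ℝ) :
    ∀ x : V6,
      sigma p q r s u w τ 0 5 x + sigma p q r s u w τ 1 4 x + sigma p q r s u w τ 2 3 x = 0 := by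
  intro x
  have h0 : ee 0 = ![1,0,0,0,0,0] := by ext i; fin_cases i <;> simp [ee]
  have h1 : ee 1 = ![0,1,0,0,0,0] := by ext i; fin_cases i <;> simp [ee]
  have h2 : ee 2 = ![0,0,1,0,0,0] := by ext i; fin_cases i <;> simp [ee]
  have h3 : ee 3 = ![0,0,0,1,0,0] := by ext i; fin_cases i <;> simp [ee]
  have h4 : ee 4 = ![0,0,0,0,1,0] := by ext i; fin_cases i <;> simp [ee]
  have h5 : ee 5 = ![0,0,0,0,0,1] := by ext i; fin_cases i <;> simp [ee]
  simp only [sigma, Fin.sum_univ_six, cst, dOmega, d2, omega2, br, bD, Jm, h0, h1, h2, h3, h4, h5]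
  simp
  ring
end
end

section
/- Under the balanced almost-abelian structure equations, if the structure (ω,J) is Kähler, i.e. A is skew-symmetric (A + Aᵀ = 0 in the orthonormal basis e₂,…,e₅), then tr(Ω^τ∧Ω^τ) = 0 for every τ ∈ ℝ. -/
noncomputable section

open Matrix

theorem dOmega_zero (q r s : ℝ) (x y z : V6) : dOmega 0 q r s (-q) r x y z = 0 := by
  simp [dOmega, d2, omega2, br, bD]
  ring

theorem cst_zero (q r s : ℝ) (i j k : Fin 6) (hk : k ≠ 5) :
    cst 0 q r s (-q) r i j k - cst 0 q r s (-q) r k i j + cst 0 q r s (-q) r j k i = 0 := by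
  fin_cases k <;> first | exact absurd rfl hk | skip
  all_goals fin_cases i <;> fin_cases j <;> simp [cst, br, bD, ee, Pi.single_apply]

theorem sigma_form (q r s τ : ℝ) (i j : Fin 6) :
    ∃ g : ℝ, ∀ x : V6, sigma 0 q r s (-q) r τ i j x = x 5 * g := by
  refine ⟨(1/2) * (cst 0 q r s (-q) r i j 5 - cst 0 q r s (-q) r 5 i j
    + cst 0 q r s (-q) r j 5 i), fun x => ?_⟩
  unfold sigma
  rw [Finset.sum_eq_single 5]
  · simp only [dOmega_zero]; ring
  · intro k _ hk
    rw [cst_zero q r s i j k hk, dOmega_zero, dOmega_zero]; ring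
  · simp

theorem Omega_zero (q r s τ : ℝ) (i j : Fin 6) (x y : V6) :
    Omega 0 q r s (-q) r τ i j x y = 0 := by
  choose g hg using sigma_form q r s τ
  unfold Omega d1 w11
  simp only [hg]
  rw [Finset.sum_eq_zero (fun k _ => by ring)]
  simp [br, bD]

/-- Kähler implies the trace vanishes. -/
theorem stmt6 (p q r s u w τ : ℝ)
    (hKahler : Amat p q r s u w + (Amat p q r s u w)ᵀ = 0) :
    ∀ x0 x1 x2 x3 : V6, trOmOm p q r s u w τ x0 x1 x2 x3 = 0 := by
  intro x0 x1 x2 x3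
  have h00 := congrFun (congrFun hKahler 0) 0
  have h01 := congrFun (congrFun hKahler 0) 1
  have h02 := congrFun (congrFun hKahler 0) 2
  simp [Amat] at h00 h01 h02
  obtain rfl : p = 0 := by linarith
  obtain rfl : u = -q := by linarith
  obtain rfl : r = w := by linarith
  simp [trOmOm, w22, Omega_zero]
end
end

section
/- Under the balanced almost-abelian structure equations, the metric ω is pluriclosed, i.e. i∂∂̄ω = d(d^cω) = 0, if and only if A is skew-symmetric (i.e. the structure is Kähler). In other words, a balanced and pluriclosed metric in this setting is Kähler. -/
noncomputable section

open Matrix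

/-- Under the balanced almost-abelian structure equations, the metric `ω`
is pluriclosed, i.e. `i∂∂̄ω = d(d^cω) = 0`, if and only if `A` is skew-symmetric
(i.e. the structure is Kähler). -/
theorem stmt11 (p q r s u w : ℝ) :
    (∀ x0 x1 x2 x3 : V6, iddbar p q r s u w x0 x1 x2 x3 = 0) ↔
      Amat p q r s u w + (Amat p q r s u w)ᵀ = 0 := by
  constructor
  · intro h
    have h1 := h (ee 0) (ee 5) (ee 1) (ee 4)
    have h2 := h (ee 0) (ee 5) (ee 2) (ee 3)
    simp [iddbar, d3, dcOmega, dOmega, d2, omega2, br, bD, Jm, ee, Pi.single_apply] at h1 h2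
    have hp : p = 0 := by
      nlinarith [sq_nonneg p, sq_nonneg (q + u), sq_nonneg (r - w)]
    have hq : q + u = 0 := by
      nlinarith [sq_nonneg p, sq_nonneg (q + u), sq_nonneg (r - w)]
    have hr : r - w = 0 := by
      nlinarith [sq_nonneg p, sq_nonneg (q + u), sq_nonneg (r - w)]
    ext i j
    fin_cases i <;> fin_cases j <;> simp [Amat] <;> linarith
  · intro h x0 x1 x2 x3
    have hp := congrFun (congrFun h 0) 0
    have hq := congrFun (congrFun h 0) 1
    have hr := congrFun (congrFun h 0) 2
    simp [Amat] at hp hq hr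
    have hu : u = -q := by linarith
    have hw : w = r := by linarith
    subst hp hu hw
    have hd : ∀ x y z : V6, dOmega 0 q w s (-q) w x y z = 0 := by
      intro x y z
      simp [dOmega, d2, omega2, br, bD]
      ring
    simp [iddbar, d3, dcOmega, hd]
end
end

section
/- For every real n×n matrix A, with A⁺ = (A+Aᵀ)/2, A⁻ = (A−Aᵀ)/2, ⟨X,Y⟩ = tr(XYᵀ) and ‖X‖² = ⟨X,X⟩, one has ⟨[[A⁺,A⁻],A], A⟩ = −2‖[A⁺,A⁻]‖², where [X,Y] = XY − YX. -/
noncomputable section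

open Matrix

attribute [local instance] Matrix.normedAddCommGroup Matrix.normedSpace

/-- The symmetric part `X⁺ = (X + Xᵀ)/2` of a square matrix. -/
def symPart {n : ℕ} (X : Matrix (Fin n) (Fin n) ℝ) : Matrix (Fin n) (Fin n) ℝ :=
  (1/2 : ℝ) • (X + Xᵀ)

/-- The skew-symmetric part `X⁻ = (X − Xᵀ)/2` of a square matrix. -/
def skewPart {n : ℕ} (X : Matrix (Fin n) (Fin n) ℝ) : Matrix (Fin n) (Fin n) ℝ :=
  (1/2 : ℝ) • (X - Xᵀ)

/-- The matrix commutator `[X, Y] = XY − YX`. -/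
def mcomm {n : ℕ} (X Y : Matrix (Fin n) (Fin n) ℝ) : Matrix (Fin n) (Fin n) ℝ :=
  X * Y - Y * X

/-- The squared Frobenius norm `‖X‖² = ⟨X, X⟩ = tr(XXᵀ)`. -/
def nsq {n : ℕ} (X : Matrix (Fin n) (Fin n) ℝ) : ℝ := Matrix.trace (X * Xᵀ)

/-- `f(X) = 1 − c‖X⁺‖²`, where `c` corresponds to `(α'/4)·(τ(τ−1)²/8)`. -/
def fval (c : ℝ) {n : ℕ} (X : Matrix (Fin n) (Fin n) ℝ) : ℝ := 1 - c * nsq (symPart X)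

/-- The right-hand side of the reduced Anomaly flow ODE:
`f(X)·(2[[X⁺,X⁻],X] − ‖X⁺‖²·X)`. -/
def rhs (c : ℝ) {n : ℕ} (X : Matrix (Fin n) (Fin n) ℝ) : Matrix (Fin n) (Fin n) ℝ :=
  fval c X • ((2 : ℝ) • mcomm (mcomm (symPart X) (skewPart X)) X - nsq (symPart X) • X)

/-- For every real `n×n` matrix `A`, with `A⁺ = (A+Aᵀ)/2`,
`A⁻ = (A−Aᵀ)/2`, `⟨X,Y⟩ = tr(XYᵀ)` and `‖X‖² = ⟨X,X⟩`, one has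
`⟨[[A⁺,A⁻],A], A⟩ = −2‖[A⁺,A⁻]‖²`. -/
theorem stmt12 (n : ℕ) (A : Matrix (Fin n) (Fin n) ℝ) :
    Matrix.trace (mcomm (mcomm (symPart A) (skewPart A)) A * Aᵀ) =
      -2 * nsq (mcomm (symPart A) (skewPart A)) := by
  have hC : mcomm (symPart A) (skewPart A) = (1/2 : ℝ) • (Aᵀ * A - A * Aᵀ) := by
    simp only [mcomm, symPart, skewPart, smul_mul_assoc, mul_smul_comm, smul_smul,
      mul_add, add_mul, mul_sub, sub_mul]
    module
  have hT : (mcomm (symPart A) (skewPart A))ᵀ = mcomm (symPart A) (skewPart A) := by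
    rw [hC]
    simp [Matrix.transpose_mul]
  have hA : A * Aᵀ - Aᵀ * A = (-2 : ℝ) • mcomm (symPart A) (skewPart A) := by
    rw [hC]
    module
  rw [nsq, hT]
  generalize mcomm (symPart A) (skewPart A) = C at hA
  have h1 : Matrix.trace (mcomm C A * Aᵀ) = Matrix.trace (C * (A * Aᵀ - Aᵀ * A)) := by
    rw [mcomm, sub_mul, mul_sub, Matrix.trace_sub, Matrix.trace_sub, mul_assoc,
      mul_assoc A C, Matrix.trace_mul_comm A, mul_assoc C]
  rw [h1, hA, mul_smul_comm, Matrix.trace_smul, smul_eq_mul]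
end
end

section
/- Let A : I → M₄(ℝ) be a differentiable solution on an interval I containing 0 of the reduced Anomaly flow ODE A′(t) = f(A(t))·(2[[A(t)⁺,A(t)⁻],A(t)] − ‖A(t)⁺‖²·A(t)). Let J₄ ∈ M₄(ℝ) be the matrix acting on the basis (e₂,e₃,e₄,e₅) by J₄e₂ = e₅, J₄e₃ = e₄, J₄e₄ = −e₃, J₄e₅ = −e₂. If A(0) commutes with J₄, then A(t) commutes with J₄ for all t ∈ I; if moreover tr A(0) = 0 and tr(J₄A(0)) = 0, then tr A(t) = 0 and tr(J₄A(t)) = 0 for all t ∈ I. (That is, the flow consists entirely of balanced almost-abelian brackets and the holomorphic (3,0)-form stays closed.) -/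
noncomputable section

open Matrix

attribute [local instance] Matrix.normedAddCommGroup Matrix.normedSpace

theorem uniq_aux {E : Type*} [NormedAddCommGroup E] [NormedSpace ℝ E] {I : Set ℝ}
    (hI : I.OrdConnected) (h0 : (0 : ℝ) ∈ I) {T : ℝ} (hT : T ∈ I) (v : ℝ → E → E)
    (s : Set E) (K : NNReal)
    (hv : ∀ t ∈ Set.uIcc 0 T, LipschitzOnWith K (v t) s) (f g : ℝ → E)
    (hf : ∀ t ∈ I, HasDerivWithinAt f (v t (f t)) I t)
    (hg : ∀ t ∈ I, HasDerivWithinAt g (v t (g t)) I t)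
    (hfs : ∀ t ∈ Set.uIcc 0 T, f t ∈ s) (hgs : ∀ t ∈ Set.uIcc 0 T, g t ∈ s)
    (h : f 0 = g 0) : f T = g T := by
  have hsub : Set.uIcc 0 T ⊆ I := hI.uIcc_subset h0 hT
  have hfc : ContinuousOn f I := fun t ht => (hf t ht).continuousWithinAt
  have hgc : ContinuousOn g I := fun t ht => (hg t ht).continuousWithinAt
  rcases le_total 0 T with h1 | h1
  · rw [Set.uIcc_of_le h1] at *
    have key : ∀ t ∈ Set.Ico 0 T, I ∈ nhdsWithin t (Set.Ici t) := fun t ht =>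
      Filter.mem_of_superset (Icc_mem_nhdsGE_of_mem ht) hsub
    have hm : ∀ t ∈ Set.Ico 0 T, t ∈ Set.Icc 0 T := fun t ht => Set.Ico_subset_Icc_self ht
    exact ODE_solution_unique_of_mem_Icc_right (v := v) (s := fun _ => s) (K := K)
      (fun t ht => hv t (hm t ht)) (hfc.mono hsub)
      (fun t ht => (hf t (hsub (hm t ht))).mono_of_mem_nhdsWithin (key t ht))
      (fun t ht => hfs t (hm t ht)) (hgc.mono hsub)
      (fun t ht => (hg t (hsub (hm t ht))).mono_of_mem_nhdsWithin (key t ht))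
      (fun t ht => hgs t (hm t ht)) h (Set.right_mem_Icc.2 h1)
  · rw [Set.uIcc_of_ge h1] at *
    have key : ∀ t ∈ Set.Ioc T 0, I ∈ nhdsWithin t (Set.Iic t) := fun t ht =>
      Filter.mem_of_superset (Icc_mem_nhdsLE_of_mem ht) hsub
    have hm : ∀ t ∈ Set.Ioc T 0, t ∈ Set.Icc T 0 := fun t ht => Set.Ioc_subset_Icc_self ht
    exact ODE_solution_unique_of_mem_Icc_left (v := v) (s := fun _ => s) (K := K)
      (fun t ht => hv t (hm t ht)) (hfc.mono hsub)
      (fun t ht => (hf t (hsub (hm t ht))).mono_of_mem_nhdsWithin (key t ht))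
      (fun t ht => hfs t (hm t ht)) (hgc.mono hsub)
      (fun t ht => (hg t (hsub (hm t ht))).mono_of_mem_nhdsWithin (key t ht))
      (fun t ht => hgs t (hm t ht)) h (Set.left_mem_Icc.2 h1)

theorem scalar_aux {I : Set ℝ} (hI : I.OrdConnected) (h0 : (0 : ℝ) ∈ I) (a g : ℝ → ℝ)
    (ha : ContinuousOn a I) (hg : ∀ t ∈ I, HasDerivWithinAt g (a t * g t) I t)
    (h : g 0 = 0) : ∀ t ∈ I, g t = 0 := by
  intro T hT
  obtain ⟨C, hC⟩ := (isCompact_uIcc (a := (0:ℝ)) (b := T)).exists_bound_of_continuousOn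
    (ha.mono (hI.uIcc_subset h0 hT))
  refine uniq_aux hI h0 hT (fun t x => a t * x) Set.univ C.toNNReal ?_ g (fun _ => 0) hg
    (fun t _ => by simpa using hasDerivWithinAt_const t I (0:ℝ)) (fun _ _ => trivial)
    (fun _ _ => trivial) h
  intro t ht
  refine LipschitzOnWith.of_dist_le_mul fun x _ y _ => ?_
  rw [Real.dist_eq, Real.dist_eq, ← mul_sub, abs_mul]
  refine mul_le_mul_of_nonneg_right ?_ (abs_nonneg _)
  exact (hC t ht).trans (Real.le_coe_toNNReal C)

theorem cd_entry {n : ℕ} (F : Matrix (Fin n) (Fin n) ℝ → Matrix (Fin n) (Fin n) ℝ) :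
    ContDiff ℝ 1 F ↔ ∀ i j, ContDiff ℝ 1 (fun X => F X i j) := by
  refine (contDiff_pi (Φ := F)).trans (forall_congr' fun i => ?_)
  exact contDiff_pi (Φ := fun X => F X i)

theorem cd_mul {n : ℕ} {F G : Matrix (Fin n) (Fin n) ℝ → Matrix (Fin n) (Fin n) ℝ}
    (hF : ContDiff ℝ 1 F) (hG : ContDiff ℝ 1 G) : ContDiff ℝ 1 (fun X => F X * G X) := by
  rw [cd_entry] at *
  intro i j
  simp only [Matrix.mul_apply]
  exact ContDiff.sum fun k _ => (hF i k).mul (hG k j)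

theorem cd_transpose {n : ℕ} {F : Matrix (Fin n) (Fin n) ℝ → Matrix (Fin n) (Fin n) ℝ}
    (hF : ContDiff ℝ 1 F) : ContDiff ℝ 1 (fun X => (F X)ᵀ) := by
  rw [cd_entry] at *
  exact fun i j => hF j i

theorem cd_trace {n : ℕ} {F : Matrix (Fin n) (Fin n) ℝ → Matrix (Fin n) (Fin n) ℝ}
    (hF : ContDiff ℝ 1 F) : ContDiff ℝ 1 (fun X => Matrix.trace (F X)) := by
  rw [cd_entry] at hF
  exact ContDiff.sum fun k _ => hF k k

theorem cd_smul {n : ℕ} {F : Matrix (Fin n) (Fin n) ℝ → ℝ}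
    {G : Matrix (Fin n) (Fin n) ℝ → Matrix (Fin n) (Fin n) ℝ}
    (hF : ContDiff ℝ 1 F) (hG : ContDiff ℝ 1 G) : ContDiff ℝ 1 (fun X => F X • G X) :=
  hF.smul hG

theorem cd_sym {n : ℕ} : ContDiff ℝ 1 (symPart (n := n)) :=
  cd_smul contDiff_const (contDiff_id.add (cd_transpose contDiff_id))

theorem cd_skew {n : ℕ} : ContDiff ℝ 1 (skewPart (n := n)) :=
  cd_smul contDiff_const (contDiff_id.sub (cd_transpose contDiff_id))

theorem cd_nsq {n : ℕ} : ContDiff ℝ 1 (fun X => nsq (symPart (n := n) X)) :=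
  cd_trace (cd_mul cd_sym (cd_transpose cd_sym))

theorem cd_fval (c : ℝ) {n : ℕ} : ContDiff ℝ 1 (fval c (n := n)) :=
  contDiff_const.sub (contDiff_const.mul cd_nsq)

theorem cd_mcomm {n : ℕ} {F G : Matrix (Fin n) (Fin n) ℝ → Matrix (Fin n) (Fin n) ℝ}
    (hF : ContDiff ℝ 1 F) (hG : ContDiff ℝ 1 G) : ContDiff ℝ 1 (fun X => mcomm (F X) (G X)) :=
  (cd_mul hF hG).sub (cd_mul hG hF)

theorem cd_rhs (c : ℝ) {n : ℕ} : ContDiff ℝ 1 (rhs c (n := n)) :=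
  cd_smul (cd_fval c) ((cd_smul contDiff_const (cd_mcomm (cd_mcomm cd_sym cd_skew) contDiff_id)).sub
    (cd_smul cd_nsq contDiff_id))

section equivariance
variable {n : ℕ} {J : Matrix (Fin n) (Fin n) ℝ}

theorem jconj_mul (h : J * Jᵀ = 1) (X Y : Matrix (Fin n) (Fin n) ℝ) :
    (Jᵀ * X * J) * (Jᵀ * Y * J) = Jᵀ * (X * Y) * J := by
  calc _ = Jᵀ * X * (J * Jᵀ) * Y * J := by simp only [Matrix.mul_assoc]
    _ = _ := by rw [h]; simp only [Matrix.mul_assoc, Matrix.mul_one, Matrix.one_mul]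

theorem conj_transpose (X : Matrix (Fin n) (Fin n) ℝ) :
    (Jᵀ * X * J)ᵀ = Jᵀ * Xᵀ * J := by
  simp [Matrix.transpose_mul, Matrix.mul_assoc]

theorem conj_sym (X : Matrix (Fin n) (Fin n) ℝ) :
    symPart (Jᵀ * X * J) = Jᵀ * symPart X * J := by
  simp only [symPart, conj_transpose, Matrix.mul_smul, Matrix.smul_mul, Matrix.mul_add,
    Matrix.add_mul]

theorem conj_skew (X : Matrix (Fin n) (Fin n) ℝ) :
    skewPart (Jᵀ * X * J) = Jᵀ * skewPart X * J := by
  simp only [skewPart, conj_transpose, Matrix.mul_smul, Matrix.smul_mul, Matrix.mul_sub,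
    Matrix.sub_mul]

theorem conj_mcomm (h : J * Jᵀ = 1) (X Y : Matrix (Fin n) (Fin n) ℝ) :
    mcomm (Jᵀ * X * J) (Jᵀ * Y * J) = Jᵀ * mcomm X Y * J := by
  simp only [mcomm, jconj_mul h, Matrix.mul_sub, Matrix.sub_mul]

theorem conj_nsq (h : J * Jᵀ = 1) (X : Matrix (Fin n) (Fin n) ℝ) :
    nsq (Jᵀ * X * J) = nsq X := by
  rw [nsq, conj_transpose, jconj_mul h, Matrix.trace_mul_comm, ← Matrix.mul_assoc, h,
    Matrix.one_mul, nsq]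

theorem conj_rhs (c : ℝ) (h : J * Jᵀ = 1) (X : Matrix (Fin n) (Fin n) ℝ) :
    rhs c (Jᵀ * X * J) = Jᵀ * rhs c X * J := by
  simp only [rhs, fval, conj_sym, conj_skew, conj_mcomm h, conj_nsq h, Matrix.mul_smul,
    Matrix.smul_mul, Matrix.mul_sub, Matrix.sub_mul]

end equivariance

theorem J4_orth : J4 * J4ᵀ = 1 := by
  ext i j
  fin_cases i <;> fin_cases j <;> simp [J4, Matrix.mul_apply, Fin.sum_univ_four]

theorem lin_deriv {F : Type*} [NormedAddCommGroup F] [NormedSpace ℝ F] {n : ℕ}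
    (L : Matrix (Fin n) (Fin n) ℝ →ₗ[ℝ] F) {A : ℝ → Matrix (Fin n) (Fin n) ℝ}
    {A' : Matrix (Fin n) (Fin n) ℝ} {I : Set ℝ} {t : ℝ} (h : HasDerivWithinAt A A' I t) :
    HasDerivWithinAt (fun t => L (A t)) (L A') I t :=
  (LinearMap.toContinuousLinearMap L).hasFDerivAt.comp_hasDerivWithinAt t h

theorem trace_mcomm_mul {n : ℕ} (J C A : Matrix (Fin n) (Fin n) ℝ) (h : A * J = J * A) :
    Matrix.trace (J * mcomm C A) = 0 := by
  rw [mcomm, Matrix.mul_sub, Matrix.trace_sub, ← Matrix.mul_assoc J A C, ← h,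
    Matrix.mul_assoc A J C, Matrix.trace_mul_comm A, Matrix.mul_assoc, sub_self]

theorem trace_aux (c : ℝ) (I : Set ℝ) (hI : I.OrdConnected) (h0 : (0 : ℝ) ∈ I)
    (A : ℝ → Matrix (Fin 4) (Fin 4) ℝ)
    (hA : ∀ t ∈ I, HasDerivWithinAt A (rhs c (A t)) I t) (J : Matrix (Fin 4) (Fin 4) ℝ)
    (hJ : ∀ t ∈ I, A t * J = J * A t) (h : Matrix.trace (J * A 0) = 0) :
    ∀ t ∈ I, Matrix.trace (J * A t) = 0 := by
  have hAc : ContinuousOn A I := fun t ht => (hA t ht).continuousWithinAt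
  refine scalar_aux hI h0 (fun t => -(fval c (A t) * nsq (symPart (A t)))) _ ?_ ?_ h
  · exact (((cd_fval c).mul cd_nsq).neg.continuous).comp_continuousOn hAc
  · intro t ht
    have := lin_deriv ((Matrix.traceLinearMap (Fin 4) ℝ ℝ).comp (LinearMap.mulLeft ℝ J)) (hA t ht)
    have e : -(fval c (A t) * nsq (symPart (A t))) * Matrix.trace (J * A t)
        = Matrix.trace (J * rhs c (A t)) := by
      simp only [rhs, Matrix.mul_smul, Matrix.mul_sub, Matrix.trace_smul, Matrix.trace_sub,
        trace_mcomm_mul J _ _ (hJ t ht), smul_eq_mul]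
      ring
    simp only [e]
    exact this

theorem comm_aux (c : ℝ) (I : Set ℝ) (hI : I.OrdConnected) (h0 : (0 : ℝ) ∈ I)
    (A : ℝ → Matrix (Fin 4) (Fin 4) ℝ)
    (hA : ∀ t ∈ I, HasDerivWithinAt A (rhs c (A t)) I t)
    (h : A 0 * J4 = J4 * A 0) : ∀ t ∈ I, A t * J4 = J4 * A t := by
  intro T hT
  have hJ' : J4ᵀ * J4 = 1 := mul_eq_one_comm.1 J4_orth
  have hAc : ContinuousOn A I := fun t ht => (hA t ht).continuousWithinAt
  have hB : ∀ t ∈ I, HasDerivWithinAt (fun t => J4ᵀ * A t * J4) (rhs c (J4ᵀ * A t * J4)) I t := by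
    intro t ht
    rw [conj_rhs c J4_orth]
    exact lin_deriv ((LinearMap.mulRight ℝ J4).comp (LinearMap.mulLeft ℝ J4ᵀ)) (hA t ht)
  have hBc : ContinuousOn (fun t => J4ᵀ * A t * J4) I :=
    fun t ht => (hB t ht).continuousWithinAt
  have hsub := hI.uIcc_subset h0 hT
  have hcomp := ((isCompact_uIcc (a := (0:ℝ)) (b := T)).image_of_continuousOn
    (hAc.mono hsub)).union ((isCompact_uIcc (a := (0:ℝ)) (b := T)).image_of_continuousOn
    (hBc.mono hsub))
  obtain ⟨K, hK⟩ := ((cd_rhs c (n := 4)).locallyLipschitz.locallyLipschitzOn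
    (s := _)).exists_lipschitzOnWith_of_compact hcomp
  have := uniq_aux hI h0 hT (fun _ => rhs c) _ K (fun _ _ => hK) A _ hA hB
    (fun t ht => Or.inl ⟨t, ht, rfl⟩) (fun t ht => Or.inr ⟨t, ht, rfl⟩)
    (by rw [Matrix.mul_assoc, h, ← Matrix.mul_assoc, hJ', Matrix.one_mul])
  calc A T * J4 = (J4 * J4ᵀ) * (A T * J4) := by rw [J4_orth, Matrix.one_mul]
    _ = J4 * (J4ᵀ * A T * J4) := by simp only [Matrix.mul_assoc]
    _ = J4 * A T := by rw [← this]

/-- Let `A : I → M₄(ℝ)` be a differentiable solution, on an interval `I`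
containing `0`, of the reduced Anomaly flow ODE
`A′ = f(A)·(2[[A⁺,A⁻],A] − ‖A⁺‖²A)`.  If `A(0)` commutes with `J₄` then so does `A(t)` for
all `t ∈ I`; if moreover `tr A(0) = 0` and `tr(J₄A(0)) = 0`, then `tr A(t) = 0` and
`tr(J₄A(t)) = 0` for all `t ∈ I` (the flow consists of balanced almost-abelian brackets and
the holomorphic `(3,0)`-form stays closed). -/
theorem stmt13 (c : ℝ) (I : Set ℝ) (hI : I.OrdConnected) (h0 : (0 : ℝ) ∈ I)
    (A : ℝ → Matrix (Fin 4) (Fin 4) ℝ)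
    (hA : ∀ t ∈ I, HasDerivWithinAt A (rhs c (A t)) I t) :
    (A 0 * J4 = J4 * A 0 → ∀ t ∈ I, A t * J4 = J4 * A t) ∧
    ((A 0 * J4 = J4 * A 0 ∧ Matrix.trace (A 0) = 0 ∧ Matrix.trace (J4 * A 0) = 0) →
      ∀ t ∈ I, Matrix.trace (A t) = 0 ∧ Matrix.trace (J4 * A t) = 0) := by
  refine ⟨comm_aux c I hI h0 A hA, ?_⟩
  rintro ⟨h, h1, h2⟩ t ht
  refine ⟨?_, trace_aux c I hI h0 A hA J4 (comm_aux c I hI h0 A hA h) h2 t ht⟩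
  have := trace_aux c I hI h0 A hA 1 (fun t _ => by rw [Matrix.mul_one, Matrix.one_mul])
    (by rw [Matrix.one_mul]; exact h1) t ht
  rwa [Matrix.one_mul] at this
end
end

section
/- Let A : I → Mₙ(ℝ) be a differentiable solution of the reduced Anomaly flow ODE A′(t) = f(A(t))·(2[[A(t)⁺,A(t)⁻],A(t)] − ‖A(t)⁺‖²·A(t)) on an interval I. Then for every t ∈ I, (d/dt)‖A(t)‖² = 2 f(A(t))·(−4‖[A(t)⁺,A(t)⁻]‖² − ‖A(t)⁺‖²·‖A(t)‖²). In particular, on any subinterval where f(A(t)) ≥ 0, the norm ‖A(t)‖ is nonincreasing. -/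
noncomputable section

open Matrix

attribute [local instance] Matrix.normedAddCommGroup Matrix.normedSpace

theorem nsq_eq_sum {n : ℕ} (X : Matrix (Fin n) (Fin n) ℝ) :
    nsq X = ∑ i, ∑ j, X i j * X i j := by
  simp [nsq, Matrix.trace, Matrix.mul_apply]

theorem nsq_nonneg' {n : ℕ} (X : Matrix (Fin n) (Fin n) ℝ) : 0 ≤ nsq X := by
  rw [nsq_eq_sum]
  exact Finset.sum_nonneg fun i _ => Finset.sum_nonneg fun j _ => mul_self_nonneg _

theorem trace_bracket {n : ℕ} (X : Matrix (Fin n) (Fin n) ℝ) :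
    Matrix.trace (mcomm (mcomm (symPart X) (skewPart X)) X * Xᵀ)
      = -2 * nsq (mcomm (symPart X) (skewPart X)) := by
  have hB : (mcomm (symPart X) (skewPart X))ᵀ = mcomm (symPart X) (skewPart X) := by
    simp only [mcomm, symPart, skewPart, transpose_sub, transpose_mul, transpose_smul,
      transpose_add, transpose_transpose, smul_mul_smul_comm, ← smul_sub]
    congr 1
    noncomm_ring
  have hX : X * Xᵀ - Xᵀ * X = (-2 : ℝ) • mcomm (symPart X) (skewPart X) := by
    simp only [mcomm, symPart, skewPart, smul_mul_smul_comm, ← smul_sub, smul_smul]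
    have : (X + Xᵀ) * (X - Xᵀ) - (X - Xᵀ) * (X + Xᵀ)
        = (-2 : ℝ) • (X * Xᵀ - Xᵀ * X) := by
      rw [show (-2 : ℝ) • (X * Xᵀ - Xᵀ * X) = (-2 : ℤ) • (X * Xᵀ - Xᵀ * X) by
        rw [← Int.cast_smul_eq_zsmul ℝ]; norm_num]
      noncomm_ring
    rw [this, smul_smul]
    norm_num
  generalize mcomm (symPart X) (skewPart X) = B at *
  have h1 : Matrix.trace (mcomm B X * Xᵀ) = Matrix.trace (B * (X * Xᵀ - Xᵀ * X)) := by
    rw [mcomm, sub_mul, mul_sub, trace_sub, trace_sub, Matrix.mul_assoc B X,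
      Matrix.mul_assoc X B, trace_mul_comm X, Matrix.mul_assoc B]
  rw [h1, hX, nsq, hB, Matrix.mul_smul, trace_smul, smul_eq_mul]

theorem trace_rhs {n : ℕ} (c : ℝ) (X : Matrix (Fin n) (Fin n) ℝ) :
    2 * Matrix.trace (rhs c X * Xᵀ) = 2 * fval c X *
      (-4 * nsq (mcomm (symPart X) (skewPart X)) - nsq (symPart X) * nsq X) := by
  rw [rhs, smul_mul, trace_smul, sub_mul, trace_sub, smul_mul, smul_mul, trace_smul, trace_smul,
    trace_bracket, ← nsq]
  simp only [smul_eq_mul]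
  ring

theorem hasDeriv_nsq {n : ℕ} {I : Set ℝ} {t : ℝ} {A : ℝ → Matrix (Fin n) (Fin n) ℝ}
    {D : Matrix (Fin n) (Fin n) ℝ} (h : HasDerivWithinAt A D I t) :
    HasDerivWithinAt (fun τ => nsq (A τ)) (2 * Matrix.trace (D * (A t)ᵀ)) I t := by
  have hij : ∀ i j, HasDerivWithinAt (fun τ => A τ i j) (D i j) I t := fun i j =>
    (hasDerivWithinAt_pi.1 ((hasDerivWithinAt_pi.1 h) i)) j
  simp only [nsq_eq_sum]
  have := HasDerivWithinAt.fun_sum (u := Finset.univ) fun i _ =>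
    HasDerivWithinAt.fun_sum (u := Finset.univ) fun j _ => (hij i j).mul (hij i j)
  refine this.congr_deriv ?_
  simp only [Matrix.trace, Matrix.mul_apply, Matrix.diag_apply, Matrix.transpose_apply,
    Finset.mul_sum]
  exact Finset.sum_congr rfl fun i _ => Finset.sum_congr rfl fun j _ => by ring

/-- Let `A : I → Mₙ(ℝ)` be a differentiable solution of the reduced
Anomaly flow ODE `A′ = f(A)·(2[[A⁺,A⁻],A] − ‖A⁺‖²A)` on an interval `I`. Then
`(d/dt)‖A(t)‖² = 2f(A(t))·(−4‖[A(t)⁺,A(t)⁻]‖² − ‖A(t)⁺‖²·‖A(t)‖²)`; in particular, on any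
subinterval where `f(A(t)) ≥ 0` the norm `‖A(t)‖` is nonincreasing. -/
theorem stmt14 (c : ℝ) (n : ℕ) (I : Set ℝ) (hI : I.OrdConnected)
    (A : ℝ → Matrix (Fin n) (Fin n) ℝ)
    (hA : ∀ t ∈ I, HasDerivWithinAt A (rhs c (A t)) I t) :
    (∀ t ∈ I, HasDerivWithinAt (fun τ => nsq (A τ))
        (2 * fval c (A t) *
          (-4 * nsq (mcomm (symPart (A t)) (skewPart (A t))) - nsq (symPart (A t)) * nsq (A t)))
        I t) ∧
    (∀ J : Set ℝ, J ⊆ I → J.OrdConnected → (∀ t ∈ J, 0 ≤ fval c (A t)) →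
      AntitoneOn (fun t => Real.sqrt (nsq (A t))) J) := by
  have key : ∀ t ∈ I, HasDerivWithinAt (fun τ => nsq (A τ))
        (2 * fval c (A t) *
          (-4 * nsq (mcomm (symPart (A t)) (skewPart (A t))) - nsq (symPart (A t)) * nsq (A t)))
        I t := fun t ht => (hasDeriv_nsq (hA t ht)).congr_deriv (trace_rhs c (A t))
  refine ⟨key, fun J hJI hJ hf => ?_⟩
  have hanti : AntitoneOn (fun t => nsq (A t)) J := by
    refine antitoneOn_of_hasDerivWithinAt_nonpos hJ.convex
      (fun t ht => ((key t (hJI ht)).mono hJI).continuousWithinAt)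
      (fun t ht => (key t (hJI (interior_subset ht))).mono (interior_subset.trans hJI)) ?_
    intro t ht
    have h0 := hf t (interior_subset ht)
    have h1 := nsq_nonneg' (mcomm (symPart (A t)) (skewPart (A t)))
    have h2 := mul_nonneg (nsq_nonneg' (symPart (A t))) (nsq_nonneg' (A t))
    exact mul_nonpos_of_nonneg_of_nonpos (by linarith) (by linarith)
  exact fun a ha b hb hab => Real.sqrt_le_sqrt (hanti ha hb hab)
end
end
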